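/- arXiv:math/9604236 — 4 statements merged into one kernel-verified Lean document; each statement's English description precedes it below -/
import Mathlib

section
/- (Average Exit Time Lemma) The integral of the forward exit time over the entry set equals the measure of the accessible set: ∫_I t⁺ dμ = μ(A_acc). Consequently, if μ(I) > 0, the average exit time over the entry set is ⟨t⁺⟩_I = μ(A_acc)/μ(I), and this also equals the average transit time over the entry set since every point of I has backward exit time 1. -/
open MeasureTheory ENNReal NNReal

/-- Forward exit time from `A` under `f`: the least `n ≥ 1` with `f^[n] a ∉ A`
(`⊤` if no such `n` exists). For the backward exit time, apply this to the
inverse map `g` of `f`. -/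
noncomputable def exitTime {M : Type*} (f : M → M) (A : Set M) (a : M) : ℕ∞ :=
  sInf ((fun n : ℕ => (n : ℕ∞)) '' {n : ℕ | 1 ≤ n ∧ f^[n] a ∉ A})

/-- The entry set `I = A \ f(A)`. -/
def entrySet {M : Type*} (f : M → M) (A : Set M) : Set M := A \ f '' A

/-- The transit-time component `T_j`: points of the entry set with exit time `j`. -/
noncomputable def transitComp {M : Type*} (f : M → M) (A : Set M) (j : ℕ) : Set M :=
  {a ∈ entrySet f A | exitTime f A a = (j : ℕ∞)}

/-- The transit time `t_transit = t⁺ + t⁻ - 1`, where `g` is the inverse of `f`. -/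
noncomputable def transitTime {M : Type*} (f g : M → M) (A : Set M) (a : M) : ℕ∞ :=
  exitTime f A a + exitTime g A a - 1

/-- The accessible set: points of `A` with finite backward exit time
(`g` is the inverse of `f`). -/
noncomputable def accSet {M : Type*} (g : M → M) (A : Set M) : Set M :=
  {a ∈ A | exitTime g A a ≠ ⊤}

theorem lt_exitTime_iff {M : Type*} (f : M → M) (A : Set M) (a : M) (n : ℕ) :
    (n : ℕ∞) < exitTime f A a ↔ ∀ k, 1 ≤ k → k ≤ n → f^[k] a ∈ A := by
  have h1 : (n : ℕ∞) < exitTime f A a ↔ ((n + 1 : ℕ) : ℕ∞) ≤ exitTime f A a := by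
    rw [Nat.cast_add, Nat.cast_one, ENat.add_one_le_iff (ENat.natCast_ne_top n)]
  rw [h1, exitTime, le_sInf_iff]
  constructor
  · intro h k hk hkn
    by_contra hc
    have := h k ⟨k, ⟨hk, hc⟩, rfl⟩
    have := Nat.cast_le.mp this
    omega
  · rintro h _ ⟨k, ⟨hk, hc⟩, rfl⟩
    refine Nat.cast_le.mpr ?_
    by_contra hlt
    exact hc (h k hk (by omega))

theorem exitTime_ne_top_iff {M : Type*} (f : M → M) (A : Set M) (a : M) :
    exitTime f A a ≠ ⊤ ↔ ∃ k, 1 ≤ k ∧ f^[k] a ∉ A := by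
  constructor
  · intro h
    obtain ⟨n, hn⟩ := ENat.ne_top_iff_exists.mp h
    have := (lt_exitTime_iff f A a n).not.mp (by rw [← hn]; exact lt_irrefl _)
    push Not at this
    obtain ⟨k, h1, _, h2⟩ := this
    exact ⟨k, h1, h2⟩
  · rintro ⟨k, h1, h2⟩ h
    exact h2 ((lt_exitTime_iff f A a k).mp (by rw [h]; exact ENat.natCast_lt_top k) k h1 le_rfl)

theorem enat_eq_tsum (x : ℕ∞) :
    (x : ℝ≥0∞) = ∑' n : ℕ, ({m : ℕ | (m : ℕ∞) < x}.indicator 1 n : ℝ≥0∞) := by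
  rw [← tsum_subtype {m : ℕ | (m : ℕ∞) < x} (1 : ℕ → ℝ≥0∞)]
  simp only [Pi.one_apply]
  rw [ENNReal.tsum_one]
  congr 1
  cases x with
  | top => simp
  | coe n => simp [ENat.card_eq_coe_fintype_card]

theorem iter_sub {M : Type*} {f g : M → M} (hgf : Function.LeftInverse g f) (k j : ℕ) (a : M) :
    g^[k] (f^[k + j] a) = f^[j] a := by
  rw [Function.iterate_add_apply]
  exact hgf.iterate k _

theorem integral_exit {M : Type*} [MeasurableSpace M] (μ : Measure M)
    (f g : M → M) (hgf : Function.LeftInverse g f) (hfg : Function.RightInverse g f)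
    (hf : MeasurePreserving f μ μ) (hg : MeasurePreserving g μ μ)
    (A : Set M) (hA : MeasurableSet A) :
    ∫⁻ a in entrySet f A, (exitTime f A a : ℝ≥0∞) ∂μ = μ (accSet g A) := by
  have hI : ∀ a, a ∈ entrySet f A ↔ a ∈ A ∧ g a ∉ A := by
    intro a
    refine and_congr_right fun _ => not_congr ⟨?_, fun h => ⟨g a, h, hfg a⟩⟩
    rintro ⟨b, hb, rfl⟩
    rwa [hgf b]
  let D : ℕ → Set M := fun n => {a | ∀ k, 1 ≤ k → k ≤ n → f^[k] a ∈ A}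
  let C : ℕ → Set M := fun n => {b | (∀ k, k ≤ n → g^[k] b ∈ A) ∧ g^[n + 1] b ∉ A}
  have mD : ∀ n, MeasurableSet (D n) := by
    intro n
    simp only [D, Set.ofPred_forall]
    exact .iInter fun k => .iInter fun _ => .iInter fun _ => hf.measurable.iterate k hA
  have mC : ∀ n, MeasurableSet (C n) := by
    intro n
    have e : C n = (⋂ k, ⋂ (_ : k ≤ n), g^[k] ⁻¹' A) ∩ (g^[n + 1] ⁻¹' A)ᶜ := by
      ext b
      simp [C]
    rw [e]
    refine MeasurableSet.inter ?_ (hg.measurable.iterate (n + 1) hA).compl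
    exact .iInter fun k => .iInter fun _ => hg.measurable.iterate k hA
  have key : ∀ n, D n ∩ entrySet f A = f^[n] ⁻¹' C n := by
    intro n
    ext a
    have e1 : g^[n + 1] (f^[n] a) = g a := by
      rw [Function.iterate_succ_apply']
      exact congrArg g (hgf.iterate n a)
    simp only [Set.mem_inter_iff, hI, Set.mem_preimage, D, C, Set.mem_ofPred_eq, e1]
    constructor
    · rintro ⟨h, h0, h1⟩
      refine ⟨fun k hk => ?_, h1⟩
      obtain ⟨j, rfl⟩ := Nat.exists_eq_add_of_le hk
      rw [iter_sub hgf]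
      rcases Nat.eq_zero_or_pos j with rfl | hj
      · exact h0
      · exact h j hj (by omega)
    · rintro ⟨h, h1⟩
      have h' : ∀ j, j ≤ n → f^[j] a ∈ A := by
        intro j hj
        obtain ⟨k, rfl⟩ := Nat.exists_eq_add_of_le' hj
        rw [← iter_sub hgf k j]
        exact h k (by omega)
      exact ⟨fun k _ hk => h' k hk, h' 0 (Nat.zero_le _), h1⟩
  have hU : accSet g A = ⋃ n, C n := by
    ext b
    simp only [accSet, Set.mem_ofPred_eq, exitTime_ne_top_iff, Set.mem_iUnion, C]
    constructor
    · rintro ⟨hb, hex⟩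
      classical
      have hs := Nat.find_spec hex
      have hm := fun m hm => Nat.find_min hex (m := m) hm
      obtain ⟨n, hn⟩ := Nat.exists_eq_add_of_le' hs.1
      rw [hn] at hs hm
      refine ⟨n, fun k hk => ?_, hs.2⟩
      rcases Nat.eq_zero_or_pos k with rfl | hk0
      · exact hb
      · by_contra hc
        exact hm k (by omega) ⟨hk0, hc⟩
    · rintro ⟨n, h, h1⟩
      exact ⟨h 0 (Nat.zero_le _), n + 1, by omega, h1⟩
  have hd : Pairwise (Function.onFun Disjoint C) := by
    have : ∀ m n, m < n → Disjoint (C m) (C n) := fun m n hmn =>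
      Set.disjoint_left.mpr fun b hb hb' => hb.2 (hb'.1 (m + 1) hmn)
    intro m n hmn
    rcases lt_or_gt_of_ne hmn with h | h
    · exact this m n h
    · exact (this n m h).symm
  have hpt : ∀ a, (exitTime f A a : ℝ≥0∞) = ∑' n, (D n).indicator 1 a := by
    intro a
    rw [enat_eq_tsum]
    refine tsum_congr fun n => ?_
    have hiff : n ∈ {m : ℕ | (m : ℕ∞) < exitTime f A a} ↔ a ∈ D n := lt_exitTime_iff f A a n
    by_cases h : a ∈ D n
    · rw [Set.indicator_of_mem h, Set.indicator_of_mem (hiff.mpr h)]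
      rfl
    · rw [Set.indicator_of_notMem h, Set.indicator_of_notMem (mt hiff.mp h)]
  simp_rw [hpt]
  rw [lintegral_tsum fun n => (measurable_one.indicator (mD n)).aemeasurable, hU,
    measure_iUnion hd mC]
  refine tsum_congr fun n => ?_
  rw [lintegral_indicator_one (mD n), Measure.restrict_apply (mD n), key,
    (hf.iterate n).measure_preimage (mC n).nullMeasurableSet]

/-- Average Exit Time Lemma: ∫_I t⁺ dμ = μ(A_acc); hence if μ(I) > 0 the average
exit time over the entry set is μ(A_acc)/μ(I), and it equals the average transit
time over the entry set. -/
theorem average_exit_time {M : Type*} [MeasurableSpace M] (μ : Measure M)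
    (f g : M → M) (hgf : Function.LeftInverse g f) (hfg : Function.RightInverse g f)
    (hf : MeasurePreserving f μ μ) (hg : MeasurePreserving g μ μ)
    (A : Set M) (hA : MeasurableSet A) (hAfin : μ A ≠ ⊤) :
    (∫⁻ a in entrySet f A, (exitTime f A a : ℝ≥0∞) ∂μ = μ (accSet g A)) ∧
    (0 < μ (entrySet f A) →
      (μ (entrySet f A))⁻¹ * ∫⁻ a in entrySet f A, (exitTime f A a : ℝ≥0∞) ∂μ
          = μ (accSet g A) / μ (entrySet f A) ∧
      (μ (entrySet f A))⁻¹ * ∫⁻ a in entrySet f A, (transitTime f g A a : ℝ≥0∞) ∂μ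
          = μ (accSet g A) / μ (entrySet f A) ∧
      ∀ a ∈ entrySet f A, exitTime g A a = 1) := by
  have h1 := integral_exit μ f g hgf hfg hf hg A hA
  have h2 : ∀ a ∈ entrySet f A, exitTime g A a = 1 := by
    intro a ha
    have hga : g a ∉ A := fun h => ha.2 ⟨g a, h, hfg a⟩
    apply le_antisymm
    · exact sInf_le ⟨1, ⟨le_rfl, hga⟩, by simp⟩
    · refine le_sInf ?_
      rintro _ ⟨k, ⟨hk, _⟩, rfl⟩
      exact Nat.one_le_cast.mpr hk
  have hIm : MeasurableSet (entrySet f A) := by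
    have : entrySet f A = A \ g ⁻¹' A := by
      rw [entrySet, Set.image_eq_preimage_of_inverse hgf hfg]
    rw [this]
    exact hA.diff (hg.measurable hA)
  have h3 : ∫⁻ a in entrySet f A, (transitTime f g A a : ℝ≥0∞) ∂μ = μ (accSet g A) := by
    rw [← h1]
    refine setLIntegral_congr_fun hIm fun a ha => ?_
    have : transitTime f g A a = exitTime f A a := by
      rw [transitTime, h2 a ha]
      exact ENat.addLECancellable_of_ne_top ENat.one_ne_top |>.add_tsub_cancel_right
    simp only [this]
  refine ⟨h1, fun _ => ⟨?_, ?_, h2⟩⟩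
  · rw [h1, mul_comm, div_eq_mul_inv]
  · rw [h3, mul_comm, div_eq_mul_inv]
end

section
/- For every j ≥ 1, the measure of the subset of the accessible set with transit time exactly j equals j times the measure of T_j: μ({a ∈ A_acc : t_transit(a) = j}) = j · μ(T_j). -/
open MeasureTheory ENNReal NNReal

theorem exitTime_eq_coe_iff {M : Type*} (f : M → M) (A : Set M) (a : M) (n : ℕ) :
    exitTime f A a = (n : ℕ∞) ↔
      1 ≤ n ∧ f^[n] a ∉ A ∧ ∀ k, 1 ≤ k → k < n → f^[k] a ∈ A := by
  unfold exitTime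
  constructor
  · intro h
    have hne : ((fun n : ℕ => (n : ℕ∞)) '' {n : ℕ | 1 ≤ n ∧ f^[n] a ∉ A}).Nonempty := by
      by_contra hc
      rw [Set.not_nonempty_iff_eq_empty] at hc
      rw [hc] at h
      exact absurd (h.symm.trans sInf_empty) (ENat.natCast_ne_top n)
    have hm := csInf_mem hne
    rw [h] at hm
    obtain ⟨m, ⟨h1, h2⟩, h3⟩ := hm
    have h3' : m = n := by
      simp only at h3
      exact_mod_cast h3
    subst h3'
    refine ⟨h1, h2, fun k hk hkn => ?_⟩
    by_contra hc
    have : sInf ((fun n : ℕ => (n : ℕ∞)) '' {n : ℕ | 1 ≤ n ∧ f^[n] a ∉ A}) ≤ (k : ℕ∞) :=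
      sInf_le ⟨k, ⟨hk, hc⟩, rfl⟩
    rw [h] at this
    have : m ≤ k := by exact_mod_cast this
    omega
  · rintro ⟨h1, h2, h3⟩
    apply le_antisymm
    · exact sInf_le ⟨n, ⟨h1, h2⟩, rfl⟩
    · apply le_sInf
      rintro _ ⟨m, ⟨hm1, hm2⟩, rfl⟩
      by_contra hc
      have : m < n := by
        have := not_le.mp hc
        simp only at this
        exact_mod_cast this
      exact hm2 (h3 m hm1 this)

theorem iter_cancel_le {M : Type*} {f g : M → M} (h : Function.LeftInverse g f) (a : M)
    {k n : ℕ} (hk : k ≤ n) : g^[k] (f^[n] a) = f^[n - k] a := by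
  obtain ⟨d, rfl⟩ := Nat.exists_eq_add_of_le hk
  rw [Function.iterate_add_apply, h.iterate k, Nat.add_sub_cancel_left]

theorem iter_cancel_ge {M : Type*} {f g : M → M} (h : Function.LeftInverse g f) (a : M)
    {k n : ℕ} (hk : n ≤ k) : g^[k] (f^[n] a) = g^[k - n] a := by
  obtain ⟨d, rfl⟩ := Nat.exists_eq_add_of_le hk
  rw [Nat.add_comm n d, Function.iterate_add_apply, h.iterate n, Nat.add_sub_cancel]

theorem mem_transitComp_iff {M : Type*} {f g : M → M} (hgf : Function.LeftInverse g f)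
    (hfg : Function.RightInverse g f) (A : Set M) (j : ℕ) (hj : 1 ≤ j) (b : M) :
    b ∈ transitComp f A j ↔ g b ∉ A ∧ f^[j] b ∉ A ∧ ∀ k < j, f^[k] b ∈ A := by
  have e : b ∈ f '' A ↔ g b ∈ A := by
    constructor
    · rintro ⟨c, hc, rfl⟩
      rwa [hgf c]
    · intro h
      exact ⟨g b, h, hfg b⟩
  unfold transitComp entrySet
  rw [Set.mem_setOf_eq, exitTime_eq_coe_iff, Set.mem_diff, e]
  constructor
  · rintro ⟨⟨h1, h2⟩, _, h4, h5⟩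
    refine ⟨h2, h4, fun k hk => ?_⟩
    rcases Nat.eq_zero_or_pos k with rfl | hp
    · exact h1
    · exact h5 k hp hk
  · rintro ⟨h1, h2, h3⟩
    exact ⟨⟨h3 0 hj, h1⟩, hj, h2, fun k _ hk => h3 k hk⟩

theorem mem_preimage_iff {M : Type*} {f g : M → M} (hgf : Function.LeftInverse g f)
    (hfg : Function.RightInverse g f) (A : Set M) (j : ℕ) (hj : 1 ≤ j) (i : ℕ) (hi : i < j)
    (a : M) :
    g^[i] a ∈ transitComp f A j ↔ a ∈ A ∧ exitTime g A a = ((i + 1 : ℕ) : ℕ∞) ∧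
      exitTime f A a = ((j - i : ℕ) : ℕ∞) := by
  have hfg' : Function.LeftInverse f g := hfg
  rw [mem_transitComp_iff hgf hfg A j hj, exitTime_eq_coe_iff, exitTime_eq_coe_iff,
    ← Function.iterate_succ_apply' g i a, iter_cancel_ge hfg' a hi.le]
  constructor
  · rintro ⟨h1, h2, h3⟩
    have h0 := h3 i hi
    rw [iter_cancel_ge hfg' a le_rfl, Nat.sub_self] at h0
    refine ⟨h0, ⟨by omega, h1, fun k _ hk => ?_⟩, by omega, h2, fun k _ hk => ?_⟩
    · have := h3 (i - k) (by omega)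
      rw [iter_cancel_le hfg' a (by omega)] at this
      rwa [show i - (i - k) = k by omega] at this
    · have := h3 (i + k) (by omega)
      rw [iter_cancel_ge hfg' a (by omega)] at this
      rwa [show i + k - i = k by omega] at this
  · rintro ⟨h0, ⟨_, h1, h2⟩, _, h3, h4⟩
    refine ⟨h1, h3, fun k hk => ?_⟩
    rcases lt_trichotomy k i with h | h | h
    · rw [iter_cancel_le hfg' a h.le]
      exact h2 _ (by omega) (by omega)
    · rw [h, iter_cancel_ge hfg' a le_rfl, Nat.sub_self]
      exact h0
    · rw [iter_cancel_ge hfg' a h.le]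
      exact h4 _ (by omega) (by omega)

/-- For every `j ≥ 1`, μ({a ∈ A_acc : t_transit(a) = j}) = j · μ(T_j). -/
theorem measure_accSet_transitTime_eq {M : Type*} [MeasurableSpace M] (μ : Measure M)
    (f g : M → M) (hgf : Function.LeftInverse g f) (hfg : Function.RightInverse g f)
    (hf : MeasurePreserving f μ μ) (hg : MeasurePreserving g μ μ)
    (A : Set M) (hA : MeasurableSet A) (hAfin : μ A ≠ ⊤) :
    ∀ j : ℕ, 1 ≤ j →
      μ {a ∈ accSet g A | transitTime f g A a = (j : ℕ∞)}
        = (j : ℝ≥0∞) * μ (transitComp f A j) := by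
  intro j hj
  have hmeas : MeasurableSet (transitComp f A j) := by
    have : transitComp f A j = (g ⁻¹' A)ᶜ ∩ ((f^[j] ⁻¹' A)ᶜ ∩ ⋂ k, ⋂ (_ : k < j), f^[k] ⁻¹' A) := by
      ext b
      rw [mem_transitComp_iff hgf hfg A j hj]
      simp
    rw [this]
    exact (hg.measurable hA).compl.inter (((hf.measurable.iterate j) hA).compl.inter
      (MeasurableSet.iInter fun k => MeasurableSet.iInter fun _ => (hf.measurable.iterate k) hA))
  have hS : {a ∈ accSet g A | transitTime f g A a = (j : ℕ∞)}
      = ⋃ i ∈ Finset.range j, g^[i] ⁻¹' transitComp f A j := by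
    ext a
    simp only [Set.mem_setOf_eq, Set.mem_iUnion, Finset.mem_range, Set.mem_preimage, exists_prop,
      accSet, transitTime]
    constructor
    · rintro ⟨⟨h0, h1⟩, h2⟩
      obtain ⟨m, hm⟩ := ENat.ne_top_iff_exists.mp h1
      have hft : exitTime f A a ≠ ⊤ := by
        intro h
        rw [h, top_add] at h2
        exact absurd h2 (by simp)
      obtain ⟨p, hp⟩ := ENat.ne_top_iff_exists.mp hft
      have hm1 := ((exitTime_eq_coe_iff g A a m).1 hm.symm).1
      have hp1 := ((exitTime_eq_coe_iff f A a p).1 hp.symm).1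
      rw [← hm, ← hp] at h2
      have h3 : p + m - 1 = j := by exact_mod_cast h2
      refine ⟨m - 1, by omega, ?_⟩
      rw [mem_preimage_iff hgf hfg A j hj _ (by omega)]
      refine ⟨h0, ?_, ?_⟩
      · rw [← hm]; congr 1; omega
      · rw [← hp]; congr 1; omega
    · rintro ⟨i, hi, h⟩
      rw [mem_preimage_iff hgf hfg A j hj _ hi] at h
      obtain ⟨h0, h1, h2⟩ := h
      refine ⟨⟨h0, by rw [h1]; exact ENat.natCast_ne_top _⟩, ?_⟩
      rw [h1, h2]
      have : (j - i) + (i + 1) - 1 = j := by omega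
      exact_mod_cast this
  rw [hS, measure_biUnion_finset]
  · rw [Finset.sum_congr rfl fun i _ => (hg.iterate i).measure_preimage hmeas.nullMeasurableSet]
    simp
  · intro i hi k hk hik
    rw [Function.onFun, Set.disjoint_left]
    intro a h1 h2
    rw [Set.mem_preimage, mem_preimage_iff hgf hfg A j hj _ (by simpa using hi)] at h1
    rw [Set.mem_preimage, mem_preimage_iff hgf hfg A j hj _ (by simpa using hk)] at h2
    have h := h1.2.1.symm.trans h2.2.1
    have : i + 1 = k + 1 := by exact_mod_cast h
    omega
  · intro i _
    exact (hg.measurable.iterate i) hmeas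
end

section
/- For every k ≥ 1, the measure of the subset of the accessible set with forward exit time at least k is μ({a ∈ A_acc : t⁺(a) ≥ k}) = Σ_{m=k}^∞ (m − k + 1) · μ(T_m). -/
open MeasureTheory ENNReal NNReal

theorem aux_le_exit {M : Type*} (f : M → M) (A : Set M) (a : M) (n : ℕ) :
    (n : ℕ∞) ≤ exitTime f A a ↔ ∀ m, 1 ≤ m → m < n → f^[m] a ∈ A := by
  unfold exitTime
  rw [le_sInf_iff]
  constructor
  · intro h m h1 h2
    by_contra hc
    have := h (m : ℕ∞) ⟨m, ⟨h1, hc⟩, rfl⟩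
    have : n ≤ m := by exact_mod_cast this
    omega
  · rintro h _ ⟨m, ⟨h1, hc⟩, rfl⟩
    have : n ≤ m := by
      by_contra h'
      exact hc (h m h1 (by omega))
    exact Nat.cast_le.2 this

theorem aux_exit_ne_top {M : Type*} (f : M → M) (A : Set M) (a : M) :
    exitTime f A a ≠ ⊤ ↔ ∃ m, 1 ≤ m ∧ f^[m] a ∉ A := by
  constructor
  · intro h
    by_contra! hc
    apply h
    rw [ENat.eq_top_iff_forall_ge]
    intro n
    rw [aux_le_exit]
    exact fun m h1 _ => hc m h1
  · rintro ⟨m, h1, h2⟩ ht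
    have : ((m+1 : ℕ) : ℕ∞) ≤ exitTime f A a := by rw [ht]; exact le_top
    exact h2 ((aux_le_exit f A a _).1 this m h1 (by omega))

/-- Entry points with exit time at least `n` (for `n ≥ 1`). -/
def auxE {M : Type*} (f g : M → M) (A : Set M) (n : ℕ) : Set M :=
  {b | g b ∉ A ∧ ∀ m, m < n → f^[m] b ∈ A}

theorem auxE_meas {M : Type*} [MeasurableSpace M] (f g : M → M) (hf : Measurable f)
    (hg : Measurable g) (A : Set M) (hA : MeasurableSet A) (n : ℕ) :
    MeasurableSet (auxE f g A n) := by
  have : auxE f g A n = (g ⁻¹' A)ᶜ ∩ ⋂ m, ⋂ (_ : m < n), (f^[m]) ⁻¹' A := by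
    ext b; simp [auxE]
  rw [this]
  exact (hg hA).compl.inter
    (MeasurableSet.iInter fun m => MeasurableSet.iInter fun _ => (hf.iterate m) hA)

theorem aux_mem_entry {M : Type*} (f g : M → M) (hgf : Function.LeftInverse g f)
    (hfg : Function.RightInverse g f) (A : Set M) (b : M) :
    b ∈ entrySet f A ↔ b ∈ A ∧ g b ∉ A := by
  unfold entrySet
  rw [Set.image_eq_preimage_of_inverse hgf hfg]
  rfl

theorem auxE_iff {M : Type*} (f g : M → M) (hgf : Function.LeftInverse g f)
    (hfg : Function.RightInverse g f) (A : Set M) (n : ℕ) (hn : 1 ≤ n) (b : M) :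
    b ∈ auxE f g A n ↔ b ∈ entrySet f A ∧ (n : ℕ∞) ≤ exitTime f A b := by
  rw [aux_mem_entry f g hgf hfg, aux_le_exit]
  constructor
  · rintro ⟨h1, h2⟩
    exact ⟨⟨h2 0 (by omega), h1⟩, fun m _ h => h2 m h⟩
  · rintro ⟨⟨h1, h2⟩, h3⟩
    refine ⟨h2, fun m hm => ?_⟩
    rcases Nat.eq_zero_or_pos m with rfl | h
    · exact h1
    · exact h3 m h hm

theorem aux_fg {M : Type*} (f g : M → M)
    (hfg : Function.RightInverse g f) (m d : ℕ) (a : M) : f^[m] (g^[m + d] a) = g^[d] a := by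
  rw [Function.iterate_add_apply]
  exact Function.LeftInverse.iterate hfg m _

theorem aux_fg' {M : Type*} (f g : M → M)
    (hfg : Function.RightInverse g f) (m d : ℕ) (a : M) : f^[d + m] (g^[m] a) = f^[d] a := by
  rw [Function.iterate_add_apply]
  congr 1
  exact Function.LeftInverse.iterate hfg m _

theorem aux_disj {M : Type*} (f g : M → M)
    (hfg : Function.RightInverse g f) (A : Set M) (k : ℕ) (hk : 1 ≤ k) :
    Pairwise (Function.onFun Disjoint fun j => (g^[j]) ⁻¹' auxE f g A (k + j)) := by
  have key : ∀ i j, i < j → Disjoint ((g^[i]) ⁻¹' auxE f g A (k + i))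
      ((g^[j]) ⁻¹' auxE f g A (k + j)) := by
    intro i j hij
    rw [Set.disjoint_left]
    rintro a ⟨h1, _⟩ ⟨_, h2⟩
    apply h1
    have := h2 (j - (i+1)) (by omega)
    have e : j = (j - (i+1)) + (i+1) := by omega
    rw [← Function.iterate_succ_apply' g i a, ← aux_fg f g hfg (j - (i+1)) (i+1) a, ← e]
    exact this
  intro i j hij
  rcases lt_or_gt_of_ne hij with h | h
  · exact key i j h
  · exact (key j i h).symm

theorem aux_union {M : Type*} (f g : M → M)
    (hfg : Function.RightInverse g f) (A : Set M) (k : ℕ) (hk : 1 ≤ k) :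
    {a ∈ accSet g A | (k : ℕ∞) ≤ exitTime f A a}
      = ⋃ j, (g^[j]) ⁻¹' auxE f g A (k + j) := by
  classical
  ext a
  simp only [accSet, Set.mem_setOf_eq, aux_exit_ne_top, aux_le_exit, Set.mem_iUnion,
    Set.mem_preimage]
  constructor
  · rintro ⟨⟨ha, hex⟩, h⟩
    obtain ⟨h1, h2⟩ := Nat.find_spec hex
    have hmin : ∀ m, m < Nat.find hex → g^[m] a ∈ A := by
      intro m hm
      rcases Nat.eq_zero_or_pos m with rfl | h
      · exact ha
      · have := Nat.find_min hex hm
        by_contra hc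
        exact this ⟨h, hc⟩
    generalize Nat.find hex = n at h1 h2 hmin
    obtain ⟨j, rfl⟩ : ∃ j, n = j + 1 := ⟨n - 1, by omega⟩
    refine ⟨j, ?_, ?_⟩
    · rw [← Function.iterate_succ_apply' g j a]; exact h2
    · intro m hm
      rcases le_or_gt m j with hmj | hmj
      · obtain ⟨d, rfl⟩ := Nat.exists_eq_add_of_le hmj
        rw [aux_fg f g hfg]
        exact hmin d (by omega)
      · obtain ⟨d, rfl⟩ := Nat.exists_eq_add_of_le' hmj.le
        rw [aux_fg' f g hfg]
        exact h d (by omega) (by omega)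
  · rintro ⟨j, h1, h2⟩
    refine ⟨⟨?_, j + 1, by omega, ?_⟩, ?_⟩
    · have := h2 (0 + j) (by omega)
      rwa [aux_fg' f g hfg] at this
    · rw [Function.iterate_succ_apply' g j a]; exact h1
    · intro m _ hm
      have := h2 (m + j) (by omega)
      rwa [aux_fg' f g hfg] at this

theorem aux_meas_union {M : Type*} [MeasurableSpace M] (μ : Measure M)
    (f g : M → M) (hfg : Function.RightInverse g f)
    (hf : MeasurePreserving f μ μ) (hg : MeasurePreserving g μ μ)
    (A : Set M) (hA : MeasurableSet A) (k : ℕ) (hk : 1 ≤ k) :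
    μ {a ∈ accSet g A | (k : ℕ∞) ≤ exitTime f A a} = ∑' j, μ (auxE f g A (k + j)) := by
  have hE := auxE_meas f g hf.measurable hg.measurable A hA
  rw [aux_union f g hfg A k hk, measure_iUnion (aux_disj f g hfg A k hk)
    (fun j => (hg.measurable.iterate j) (hE _))]
  exact tsum_congr fun j => (hg.iterate j).measure_preimage (hE _).nullMeasurableSet

theorem aux_T {M : Type*} (f g : M → M) (hgf : Function.LeftInverse g f)
    (hfg : Function.RightInverse g f) (A : Set M) (n : ℕ) (hn : 1 ≤ n) :
    transitComp f A n = auxE f g A n \ auxE f g A (n + 1) := by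
  ext b
  rw [Set.mem_diff, auxE_iff f g hgf hfg A n hn, auxE_iff f g hgf hfg A (n+1) (by omega)]
  simp only [transitComp, Set.mem_setOf_eq]
  generalize exitTime f A b = t
  have : t = (n : ℕ∞) ↔ (n : ℕ∞) ≤ t ∧ ¬ ((n + 1 : ℕ) : ℕ∞) ≤ t := by
    induction t using ENat.recTopCoe with
    | top => simp
    | coe t => norm_cast; omega
  rw [this]; tauto

theorem aux_E_sum {M : Type*} [MeasurableSpace M] (μ : Measure M)
    (f g : M → M) (hgf : Function.LeftInverse g f) (hfg : Function.RightInverse g f)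
    (hf : MeasurePreserving f μ μ) (hg : MeasurePreserving g μ μ)
    (A : Set M) (hA : MeasurableSet A) (hAfin : μ A ≠ ⊤) (n : ℕ) (hn : 1 ≤ n) :
    μ (auxE f g A n) = ∑' i, μ (transitComp f A (n + i)) := by
  have hE := auxE_meas f g hf.measurable hg.measurable A hA
  have hT : ∀ i, MeasurableSet (transitComp f A (n + i)) := fun i => by
    rw [aux_T f g hgf hfg A _ (by omega)]
    exact (hE _).diff (hE _)
  have h0 : μ (⋂ m, auxE f g A m) = 0 := by
    by_contra hne
    have h1 := ENNReal.tsum_const_eq_top_of_ne_zero (α := ℕ) hne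
    have h2 : ∑' _ : ℕ, μ (⋂ m, auxE f g A m) ≤ μ A := by
      calc _ ≤ ∑' j, μ (auxE f g A (1 + j)) :=
            ENNReal.tsum_le_tsum fun j => measure_mono (Set.iInter_subset _ _)
        _ = _ := (aux_meas_union μ f g hfg hf hg A hA 1 le_rfl).symm
        _ ≤ _ := measure_mono fun a ha => ha.1.1
    rw [h1] at h2
    exact hAfin (top_le_iff.1 h2)
  have hdisj : Pairwise (Function.onFun Disjoint fun i => transitComp f A (n + i)) := by
    intro i j hij
    refine Set.disjoint_left.2 fun a ha hb => hij ?_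
    have := ha.2.symm.trans hb.2
    have : n + i = n + j := by exact_mod_cast this
    omega
  rw [← measure_iUnion hdisj hT]
  apply le_antisymm
  · have hsub : auxE f g A n ⊆ (⋃ i, transitComp f A (n + i)) ∪ ⋂ m, auxE f g A m := by
      intro b hb
      obtain ⟨hbI, hbt⟩ := (auxE_iff f g hgf hfg A n hn b).1 hb
      by_cases ht : exitTime f A b = ⊤
      · right
        refine Set.mem_iInter.2 fun m => ?_
        have := (auxE_iff f g hgf hfg A (m+1) (by omega) b).2 ⟨hbI, by rw [ht]; exact le_top⟩
        exact ⟨this.1, fun i hi => this.2 i (by omega)⟩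
      · left
        obtain ⟨t, ht⟩ := ENat.ne_top_iff_exists.1 ht
        rw [← ht] at hbt
        have hnt : n ≤ t := by exact_mod_cast hbt
        obtain ⟨d, rfl⟩ := Nat.exists_eq_add_of_le hnt
        exact Set.mem_iUnion.2 ⟨d, hbI, ht.symm⟩
    calc _ ≤ _ := measure_mono hsub
      _ ≤ _ := measure_union_le _ _
      _ = _ := by rw [h0, add_zero]
  · apply measure_mono
    refine Set.iUnion_subset fun i b hb => ?_
    refine (auxE_iff f g hgf hfg A n hn b).2 ⟨hb.1, ?_⟩
    rw [hb.2]
    exact_mod_cast Nat.le_add_right n i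

theorem aux_sum (u : ℕ → ℝ≥0∞) :
    ∑' j, ∑' i, u (j + i) = ∑' n : ℕ, ((n + 1 : ℕ) : ℝ≥0∞) * u n := by
  rw [← ENNReal.tsum_prod (f := fun j i => u (j + i)),
    ← Equiv.tsum_eq (Finset.HasAntidiagonal.sigmaAntidiagonalEquivProd (A := ℕ)) (fun p : ℕ × ℕ => u (p.1 + p.2)), ENNReal.tsum_sigma']
  refine tsum_congr fun n => ?_
  have : ∀ p : Finset.HasAntidiagonal.antidiagonal n, u (p.1.1 + p.1.2) = u n := fun p => by
    rw [Finset.HasAntidiagonal.mem_antidiagonal.1 p.2]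
  simp only [Finset.HasAntidiagonal.sigmaAntidiagonalEquivProd_apply, this]
  rw [tsum_fintype]
  simp

/-- For every `k ≥ 1`, μ({a ∈ A_acc : t⁺(a) ≥ k}) = Σ_{m=k}^∞ (m - k + 1) · μ(T_m). -/
theorem measure_accSet_exitTime_ge {M : Type*} [MeasurableSpace M] (μ : Measure M)
    (f g : M → M) (hgf : Function.LeftInverse g f) (hfg : Function.RightInverse g f)
    (hf : MeasurePreserving f μ μ) (hg : MeasurePreserving g μ μ)
    (A : Set M) (hA : MeasurableSet A) (hAfin : μ A ≠ ⊤) :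
    ∀ k : ℕ, 1 ≤ k →
      μ {a ∈ accSet g A | (k : ℕ∞) ≤ exitTime f A a}
        = ∑' i : ℕ, ((i + 1 : ℕ) : ℝ≥0∞) * μ (transitComp f A (k + i)) := by
  intro k hk
  rw [aux_meas_union μ f g hfg hf hg A hA k hk, ← aux_sum fun n => μ (transitComp f A (k + n))]
  refine tsum_congr fun j => ?_
  rw [aux_E_sum μ f g hgf hfg hf hg A hA hAfin (k + j) (by omega)]
  simp only [add_assoc]
end

section
/- For the diagonal linear map on ℝⁿ with eigenvalues λ₁, …, λ_d > 1 and 0 < μ_{d+1}, …, μ_n < 1, with total expansion Λ = λ₁⋯λ_d and total contraction Π = μ_{d+1}⋯μ_n, and A the unit hypercube [0,1]ⁿ, the transit components of the entry set of A have Lebesgue measure μ(T_j) = (Λ − 1)(1 − Π) Λ^{-j} for every j ≥ 1. -/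
open MeasureTheory ENNReal NNReal

lemma exitTime_eq_iff {M : Type*} (f : M → M) (A : Set M) (a : M) (j : ℕ) (hj : 1 ≤ j) :
    exitTime f A a = (j : ℕ∞) ↔ f^[j] a ∉ A ∧ ∀ k, 1 ≤ k → k < j → f^[k] a ∈ A := by
  unfold exitTime
  constructor
  · intro h
    have hne : ((fun n : ℕ => (n : ℕ∞)) '' {n : ℕ | 1 ≤ n ∧ f^[n] a ∉ A}).Nonempty := by
      by_contra hn
      rw [Set.not_nonempty_iff_eq_empty] at hn
      rw [hn] at h
      exact ENat.coe_ne_top j (h.symm.trans sInf_empty)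
    have hm := csInf_mem hne
    rw [h] at hm
    obtain ⟨m, ⟨_, hm2⟩, hm3⟩ := hm
    have : m = j := Nat.cast_injective (R := ℕ∞) hm3
    subst this
    refine ⟨hm2, fun k hk hkm => ?_⟩
    by_contra hc
    have h1 := sInf_le (Set.mem_image_of_mem (fun n : ℕ => (n : ℕ∞))
      (show k ∈ {n : ℕ | 1 ≤ n ∧ f^[n] a ∉ A} from ⟨hk, hc⟩))
    rw [h] at h1
    have : m ≤ k := by exact_mod_cast h1
    omega
  · rintro ⟨h1, h2⟩
    apply le_antisymm
    · exact sInf_le ⟨j, ⟨hj, h1⟩, rfl⟩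
    · apply le_sInf
      rintro _ ⟨m, ⟨hm1, hm2⟩, rfl⟩
      have : j ≤ m := by
        by_contra hc
        exact hm2 (h2 m hm1 (by omega))
      exact Nat.cast_le (α := ℕ∞).2 this

/-- Auxiliary boxes. -/
noncomputable def RBox {n : ℕ} (d : ℕ) (c : Fin n → ℝ) (k m : ℕ) : Set (Fin n → ℝ) :=
  Set.univ.pi fun i => Set.Icc 0 (if (i : ℕ) < d then ((c i) ^ k)⁻¹ else (c i) ^ m)

lemma mem_RBox {n : ℕ} (d : ℕ) (c : Fin n → ℝ) (k m : ℕ) (x : Fin n → ℝ) :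
    x ∈ RBox d c k m ↔ ∀ i, 0 ≤ x i ∧
      x i ≤ (if (i : ℕ) < d then ((c i) ^ k)⁻¹ else (c i) ^ m) := by
  simp only [RBox, Set.mem_pi, Set.mem_univ, true_imp_iff, Set.mem_Icc]

lemma volume_RBox {n : ℕ} (d : ℕ) (c : Fin n → ℝ) (hc : ∀ i, 0 < c i) (k m : ℕ) :
    volume.real (RBox d c k m) =
      ((∏ i ∈ Finset.univ.filter (fun i : Fin n => (i : ℕ) < d), c i) ^ k)⁻¹ *
      (∏ i ∈ Finset.univ.filter (fun i : Fin n => d ≤ (i : ℕ)), c i) ^ m := by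
  have h0 : ∀ i : Fin n, 0 ≤ (if (i : ℕ) < d then ((c i) ^ k)⁻¹ else (c i) ^ m) := by
    intro i
    have := hc i
    split_ifs <;> positivity
  rw [RBox, measureReal_def, volume_pi_pi, ENNReal.toReal_prod]
  simp only [Real.volume_Icc, sub_zero, ENNReal.toReal_ofReal (h0 _)]
  rw [Finset.prod_ite, Finset.prod_inv_distrib, Finset.prod_pow, Finset.prod_pow]
  simp only [not_lt]

/-- Diagonal hyperbolic map on ℝⁿ with expanding eigenvalues `c i > 1` for `i < d` and
contracting `0 < c i < 1` for `i ≥ d`; with total expansion `Λ` and contraction `P`,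
the transit components of the entry set of the unit hypercube satisfy
`μ(T_j) = (Λ - 1)(1 - P) Λ^{-j}` for all `j ≥ 1`. -/
theorem diagonal_hyperbolic_exit (n d : ℕ) (hd : 1 ≤ d) (hdn : d < n)
    (c : Fin n → ℝ)
    (hexp : ∀ i : Fin n, (i : ℕ) < d → 1 < c i)
    (hcon : ∀ i : Fin n, d ≤ (i : ℕ) → 0 < c i ∧ c i < 1)
    (f : (Fin n → ℝ) → (Fin n → ℝ)) (hfdef : f = fun x i => c i * x i)
    (A : Set (Fin n → ℝ)) (hAdef : A = Set.univ.pi fun _ => Set.Icc (0 : ℝ) 1)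
    (Λ P : ℝ)
    (hΛ : Λ = ∏ i ∈ Finset.univ.filter (fun i : Fin n => (i : ℕ) < d), c i)
    (hP : P = ∏ i ∈ Finset.univ.filter (fun i : Fin n => d ≤ (i : ℕ)), c i) :
    ∀ j : ℕ, 1 ≤ j →
      volume (transitComp f A j)
        = ENNReal.ofReal ((Λ - 1) * (1 - P) * Λ ^ (-(j : ℤ))) := by
  intro j hj
  obtain ⟨k, rfl⟩ : ∃ k, j = k + 1 := ⟨j - 1, by omega⟩
  have hc : ∀ i, 0 < c i := fun i => by
    by_cases h : (i : ℕ) < d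
    · linarith [hexp i h]
    · exact (hcon i (by omega)).1
  have hiter : ∀ k a i, f^[k] a i = c i ^ k * a i := by
    intro k
    induction k with
    | zero => simp
    | succ k ih =>
      intro a i
      rw [Function.iterate_succ_apply', hfdef]
      simp only
      rw [← hfdef, ih, pow_succ]; ring
  have hA : ∀ x, x ∈ A ↔ ∀ i, 0 ≤ x i ∧ x i ≤ 1 := by
    intro x; simp only [hAdef, Set.mem_pi, Set.mem_univ, true_imp_iff, Set.mem_Icc]
  have hit : ∀ k a, a ∈ A → (f^[k] a ∈ A ↔ a ∈ RBox d c k 0) := by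
    intro k a ha
    rw [hA] at ha
    rw [hA, mem_RBox]
    refine forall_congr' fun i => ?_
    rw [hiter]
    have hp := pow_pos (hc i) k
    have h0 := (ha i).1
    have h1 := (ha i).2
    have h2 : 0 ≤ c i ^ k * a i := by positivity
    simp only [h0, h2, true_and]
    split_ifs with h
    · rw [← one_div, le_div_iff₀' hp]
    · simp only [pow_zero, h1, iff_true]
      exact mul_le_one₀ (pow_le_one₀ (hc i).le (hcon i (by omega)).2.le) h0 h1
  have himg : ∀ a, a ∈ f '' A ↔ ∀ i, 0 ≤ a i ∧ a i ≤ c i := by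
    intro a
    constructor
    · rintro ⟨x, hx, rfl⟩ i
      have := (hA x).1 hx i
      have hci := hc i
      rw [hfdef]
      exact ⟨mul_nonneg hci.le this.1, mul_le_of_le_one_right hci.le this.2⟩
    · intro h
      refine ⟨fun i => a i / c i, (hA _).2 fun i => ⟨div_nonneg (h i).1 (hc i).le, ?_⟩, ?_⟩
      · exact (div_le_one (hc i)).2 (h i).2
      · rw [hfdef]; funext i
        have := (hc i).ne'
        field_simp
  have hinv : ∀ (l : ℕ) (i : Fin n), (i : ℕ) < d → (c i ^ l)⁻¹ ≤ 1 := fun l i h =>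
    inv_le_one_of_one_le₀ (one_le_pow₀ (hexp i h).le)
  have hRA : ∀ l, RBox d c l 0 ⊆ A := by
    intro l x hx
    rw [mem_RBox] at hx
    refine (hA x).2 fun i => ⟨(hx i).1, (hx i).2.trans ?_⟩
    split_ifs with h
    · exact hinv l i h
    · simp
  have hanti : ∀ l l' m, l ≤ l' → RBox d c l' m ⊆ RBox d c l m := by
    intro l l' m hl x hx
    rw [mem_RBox] at hx ⊢
    refine fun i => ⟨(hx i).1, (hx i).2.trans ?_⟩
    split_ifs with h
    · exact inv_anti₀ (pow_pos (hc i) l) (pow_le_pow_right₀ (hexp i h).le hl)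
    · exact le_rfl
  have hR1 : ∀ l, ∀ a ∈ RBox d c l 0, (a ∈ f '' A ↔ a ∈ RBox d c l 1) := by
    intro l a ha
    rw [mem_RBox] at ha
    rw [himg, mem_RBox]
    refine forall_congr' fun i => and_congr_right fun h0 => ?_
    have := (ha i).2
    split_ifs with h
    · simp only [h, if_true] at this
      simp only [this, iff_true]
      linarith [hinv l i h, hexp i h]
    · simp
  have hR10 : ∀ l, RBox d c l 1 ⊆ RBox d c l 0 := by
    intro l x hx
    rw [mem_RBox] at hx ⊢
    refine fun i => ⟨(hx i).1, (hx i).2.trans ?_⟩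
    split_ifs with h
    · exact le_rfl
    · simpa using (hcon i (by omega)).2.le
  have hset : transitComp f A (k + 1) = (RBox d c k 0 \ RBox d c (k+1) 0) \
      (RBox d c k 1 \ RBox d c (k+1) 1) := by
    ext a
    have e : a ∈ transitComp f A (k+1) ↔ (a ∈ A ∧ a ∉ f '' A) ∧
        (f^[k+1] a ∉ A ∧ ∀ l, 1 ≤ l → l < k + 1 → f^[l] a ∈ A) := by
      rw [← exitTime_eq_iff f A a (k+1) hj]; rfl
    rw [e]
    have h1 := hR1 k a
    have h2 := hR1 (k+1) a
    have h3 := @hR10 k a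
    have h4 := @hR10 (k+1) a
    have h5 := @hRA k a
    simp only [Set.mem_sdiff]
    constructor
    · rintro ⟨⟨ha, hb⟩, hc1, hd1⟩
      have hk : a ∈ RBox d c k 0 := by
        rw [← hit k a ha]
        rcases Nat.eq_zero_or_pos k with rfl | hk
        · exact ha
        · exact hd1 k hk (by omega)
      rw [hit _ a ha] at hc1
      tauto
    · rintro ⟨⟨hk, hk1⟩, hn⟩
      have ha := h5 hk
      rw [hit _ a ha]
      refine ⟨⟨ha, by tauto⟩, hk1, fun l _ hl => ?_⟩
      rw [hit _ a ha]
      exact hanti l k 0 (by omega) hk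
  have hfin : ∀ l m, volume (RBox d c l m) ≠ ⊤ := fun l m =>
    (isCompact_univ_pi fun _ => isCompact_Icc).measure_lt_top.ne
  have hmeas : ∀ l m, MeasurableSet (RBox d c l m) := fun l m =>
    MeasurableSet.univ_pi fun _ => measurableSet_Icc
  have hsub : RBox d c k 1 \ RBox d c (k+1) 1 ⊆ RBox d c k 0 \ RBox d c (k+1) 0 := by
    rintro a ⟨h1, h2⟩
    refine ⟨hR10 k h1, fun h3 => h2 ?_⟩
    exact (hR1 (k+1) a h3).1 ((hR1 k a (hR10 k h1)).2 h1)
  have hf1 : volume (RBox d c k 0 \ RBox d c (k+1) 0) ≠ ⊤ :=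
    measure_ne_top_of_subset Set.sdiff_subset (hfin k 0)
  have hΛ0 : 0 < Λ := by rw [hΛ]; exact Finset.prod_pos fun i _ => hc i
  rw [← ENNReal.ofReal_toReal (a := volume (transitComp f A (k+1)))
    (by rw [hset]; exact measure_ne_top_of_subset Set.sdiff_subset hf1), ← measureReal_def, hset,
    measureReal_sdiff hsub ((hmeas _ _).diff (hmeas _ _)) hf1,
    measureReal_sdiff (hanti k (k+1) 0 (by omega)) (hmeas _ _) (hfin _ _),
    measureReal_sdiff (hanti k (k+1) 1 (by omega)) (hmeas _ _) (hfin _ _)]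
  simp only [volume_RBox d c hc, ← hΛ, ← hP]
  congr 1
  rw [zpow_neg, zpow_natCast]
  field_simp
  ring
end
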